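/- arXiv:2304.03876 — 3 statements merged into one kernel-verified Lean document; each statement's English description precedes it below -/
import Mathlib

section
/- Let (X,d) be a metric space and let u, u_1, u_2, … be fuzzy sets in F¹_USC(X). Then H_send(u_n, u) → 0 if and only if H_end(u_n, u) → 0 and H([u_n]_0, [u]_0) → 0. -/
open Set Filter Topology MeasureTheory
open scoped ENNReal NNReal

noncomputable section

/-- `sup_{a ∈ A} inf_{b ∈ B} ρ a b`, valued in `ℝ≥0∞`. -/
def hStar {Y : Type*} (ρ : Y → Y → ℝ≥0∞) (A B : Set Y) : ℝ≥0∞ :=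
  ⨆ a ∈ A, ⨅ b ∈ B, ρ a b

/-- Hausdorff (extended) distance with respect to the distance `ρ`:
`H(A,B) = max (H*(A,B)) (H*(B,A))`. -/
def hDist {Y : Type*} (ρ : Y → Y → ℝ≥0∞) (A B : Set Y) : ℝ≥0∞ :=
  max (hStar ρ A B) (hStar ρ B A)

/-- Kuratowski lower limit of a sequence of sets. -/
def KurLiminf {Y : Type*} [TopologicalSpace Y] (C : ℕ → Set Y) : Set Y :=
  {y | ∃ f : ℕ → Y, (∀ n, f n ∈ C n) ∧ Tendsto f atTop (𝓝 y)}

/-- Kuratowski upper limit of a sequence of sets. -/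
def KurLimsup {Y : Type*} [TopologicalSpace Y] (C : ℕ → Set Y) : Set Y :=
  {y | ∃ φ : ℕ → ℕ, StrictMono φ ∧ ∃ f : ℕ → Y,
      (∀ k, f k ∈ C (φ k)) ∧ Tendsto f atTop (𝓝 y)}

/-- Kuratowski convergence of a sequence of sets to a set. -/
def KurConv {Y : Type*} [TopologicalSpace Y] (C : ℕ → Set Y) (L : Set Y) : Prop :=
  KurLiminf C = L ∧ KurLimsup C = L

/-- A set `P` is dense in the set `S` (in particular `P ⊆ S`). -/
def DenseIn {Y : Type*} [TopologicalSpace Y] (P S : Set Y) : Prop :=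
  P ⊆ S ∧ S ⊆ closure P

variable {X : Type*} [MetricSpace X]

/-- Hausdorff distance `H*` between subsets of the metric space `X`. -/
def HXstar (A B : Set X) : ℝ≥0∞ := hStar edist A B

/-- Hausdorff distance `H` between subsets of the metric space `X`. -/
def HXdist (A B : Set X) : ℝ≥0∞ := hDist edist A B

/-- The metric `d̄` on `X × [0,1]` (modelled on `X × ℝ`):
`d̄((x,α),(y,β)) = d(x,y) + |α - β|`. -/
def dbar (p q : X × ℝ) : ℝ≥0∞ := edist p.1 q.1 + edist p.2 q.2

/-- `H*` for subsets of `(X × [0,1], d̄)`. -/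
def HPstar (A B : Set (X × ℝ)) : ℝ≥0∞ := hStar dbar A B

/-- Hausdorff distance for subsets of `(X × [0,1], d̄)`. -/
def HPdist (A B : Set (X × ℝ)) : ℝ≥0∞ := hDist dbar A B

/-- The α-cut of a fuzzy set `u : X → ℝ`:  `[u]_α = {x | u x ≥ α}` for `α ≠ 0`, and
`[u]_0 = closure {x | u x > 0}`. -/
def acut (u : X → ℝ) (α : ℝ) : Set X :=
  if α = 0 then closure {x | 0 < u x} else {x | α ≤ u x}

/-- The endograph of `u`: `{(x,t) ∈ X × [0,1] : u x ≥ t}`. -/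
def endograph (u : X → ℝ) : Set (X × ℝ) :=
  {p : X × ℝ | p.2 ∈ Icc (0:ℝ) 1 ∧ p.2 ≤ u p.1}

/-- The sendograph of `u`: `end u ∩ ([u]_0 × [0,1])`. -/
def sendograph (u : X → ℝ) : Set (X × ℝ) :=
  endograph u ∩ ((acut u 0) ×ˢ (Icc (0:ℝ) 1))

/-- `F¹_USC(X)`: normal upper semicontinuous fuzzy sets with values in `[0,1]`, i.e. all
α-cuts (`α ∈ [0,1]`) are nonempty and closed. -/
def FUSC (u : X → ℝ) : Prop :=
  (∀ x, u x ∈ Icc (0:ℝ) 1) ∧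
    ∀ α ∈ Icc (0:ℝ) 1, (acut u α).Nonempty ∧ IsClosed (acut u α)

/-- `F¹_USCG(X)`: members of `F¹_USC(X)` whose α-cuts are compact for `α ∈ (0,1]`. -/
def FUSCG (u : X → ℝ) : Prop :=
  FUSC u ∧ ∀ α ∈ Ioc (0:ℝ) 1, IsCompact (acut u α)

/-- `F¹_USCB(X)`: members of `F¹_USC(X)` whose 0-cut is compact. -/
def FUSCB (u : X → ℝ) : Prop :=
  FUSC u ∧ IsCompact (acut u 0)

/-- The endograph metric `H_end`. -/
def Hend (u v : X → ℝ) : ℝ≥0∞ := HPdist (endograph u) (endograph v)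

/-- The sendograph metric `H_send`. -/
def Hsend (u v : X → ℝ) : ℝ≥0∞ := HPdist (sendograph u) (sendograph v)

/-- Γ-convergence: Kuratowski convergence of the endographs in `X × [0,1]`. -/
def GammaConv (un : ℕ → X → ℝ) (u : X → ℝ) : Prop :=
  KurConv (fun n => endograph (un n)) (endograph u)

/-- `P(u)`: the set of `α ∈ (0,1)` such that `closure {u > α}` is a proper subset of `[u]_α`. -/
def Pset (u : X → ℝ) : Set ℝ :=
  {α ∈ Ioo (0:ℝ) 1 | closure {x | α < u x} ⊂ acut u α}

/-- `D(u)`: the set of `α ∈ (0,1)` such that `[u]_α ⊄ closure {u > α}`. -/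
def Dset (u : X → ℝ) : Set ℝ :=
  {α ∈ Ioo (0:ℝ) 1 | ¬ acut u α ⊆ closure {x | α < u x}}

/-- `P₀(u) = (0,1) \ {α ∈ (0,1) : lim_{β → α} H([u]_β , [u]_α) = 0}`. -/
def P0set (u : X → ℝ) : Set ℝ :=
  Ioo (0:ℝ) 1 \
    {α | Tendsto (fun β => HXdist (acut u β) (acut u α)) (𝓝[Icc (0:ℝ) 1] α) (𝓝 0)}

/-- The `d_p^*` distance on fuzzy sets. -/
def dpstar (p : ℝ) (u v : X → ℝ) : ℝ≥0∞ :=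
  ⨅ f ∈ {f : ℝ → ℝ≥0∞ | Measurable f ∧
      ∀ α ∈ Icc (0:ℝ) 1, HXdist (acut u α) (acut v α) ≤ f α},
    (∫⁻ α in Icc (0:ℝ) 1, f α ^ p) ^ (1 / p)


lemma iInf_le_hStar {Y : Type*} {ρ : Y → Y → ℝ≥0∞} {A B : Set Y} {a : Y}
    (ha : a ∈ A) : ⨅ b ∈ B, ρ a b ≤ hStar ρ A B :=
  le_iSup₂ (f := fun a (_ : a ∈ A) => ⨅ b ∈ B, ρ a b) a ha

lemma mem_acut_zero_of_pos {u : X → ℝ} {x : X} (hx : 0 < u x) : x ∈ acut u 0 := by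
  rw [acut, if_pos rfl]
  exact subset_closure hx

lemma mem_sendograph_of_pos {u : X → ℝ} {p : X × ℝ} (hp : p ∈ endograph u) (h : 0 < p.2) :
    p ∈ sendograph u :=
  ⟨hp, mem_acut_zero_of_pos (h.trans_le hp.2), hp.1⟩

lemma mk_zero_mem_endograph {Y : Type*} {u : Y → ℝ} (hu : ∀ x, 0 ≤ u x) (x : Y) :
    (x, (0 : ℝ)) ∈ endograph u :=
  ⟨⟨le_rfl, zero_le_one⟩, hu x⟩

lemma mk_zero_mem_sendograph {u : X → ℝ} (hu : ∀ x, 0 ≤ u x) {x : X} (hx : x ∈ acut u 0) :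
    (x, (0 : ℝ)) ∈ sendograph u :=
  ⟨mk_zero_mem_endograph hu x, hx, le_rfl, zero_le_one⟩

lemma hStar_acut_zero_le {u v : X → ℝ} (hu : ∀ x, 0 ≤ u x) :
    hStar edist (acut u 0) (acut v 0) ≤ hStar dbar (sendograph u) (sendograph v) := by
  refine iSup₂_le fun x hx => le_trans ?_ (iInf_le_hStar (mk_zero_mem_sendograph hu hx))
  exact le_iInf₂ fun q hq => (iInf₂_le q.1 hq.2.1).trans le_self_add

lemma hStar_endograph_le {u v : X → ℝ} (hv : ∀ x, 0 ≤ v x) :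
    hStar dbar (endograph u) (endograph v) ≤ hStar dbar (sendograph u) (sendograph v) := by
  refine iSup₂_le fun p hp => ?_
  rcases hp.1.1.eq_or_lt with h | h
  · refine (iInf₂_le (p.1, 0) (mk_zero_mem_endograph hv p.1)).trans ?_
    simp [dbar, ← h]
  · refine le_trans ?_ (iInf_le_hStar (mem_sendograph_of_pos hp h))
    exact le_iInf₂ fun q hq => iInf₂_le q hq.1

lemma hStar_sendograph_le {u v : X → ℝ} (hv : ∀ x, 0 ≤ v x) :
    hStar dbar (sendograph u) (sendograph v) ≤
      hStar dbar (endograph u) (endograph v) + hStar edist (acut u 0) (acut v 0) := by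
  refine iSup₂_le fun p hp => le_trans ?_
    (add_le_add (iInf_le_hStar hp.1) (iInf_le_hStar hp.2.1))
  simp_rw [ENNReal.iInf_add]
  refine le_iInf₂ fun q hq => ?_
  rcases hq.1.1.eq_or_lt with h | h
  · simp_rw [ENNReal.add_iInf]
    refine le_iInf₂ fun z hz => (iInf₂_le (z, 0) (mk_zero_mem_sendograph hv hz)).trans ?_
    rw [dbar, dbar, ← h, add_comm]
    gcongr
    exact le_add_self
  · exact (iInf₂_le q (mem_sendograph_of_pos hq h)).trans le_self_add

lemma HXdist_acut_zero_le_Hsend {u v : X → ℝ} (hu : ∀ x, 0 ≤ u x) (hv : ∀ x, 0 ≤ v x) :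
    HXdist (acut u 0) (acut v 0) ≤ Hsend u v :=
  max_le_max (hStar_acut_zero_le hu) (hStar_acut_zero_le hv)

lemma Hend_le_Hsend {u v : X → ℝ} (hu : ∀ x, 0 ≤ u x) (hv : ∀ x, 0 ≤ v x) :
    Hend u v ≤ Hsend u v :=
  max_le_max (hStar_endograph_le hv) (hStar_endograph_le hu)

lemma Hsend_le_Hend_add {u v : X → ℝ} (hu : ∀ x, 0 ≤ u x) (hv : ∀ x, 0 ≤ v x) :
    Hsend u v ≤ Hend u v + HXdist (acut u 0) (acut v 0) :=
  max_le
    ((hStar_sendograph_le hv).trans (add_le_add (le_max_left _ _) (le_max_left _ _)))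
    ((hStar_sendograph_le hu).trans (add_le_add (le_max_right _ _) (le_max_right _ _)))

/-- `H_send` convergence iff `H_end` convergence together with Hausdorff
convergence of the 0-cuts. -/
theorem stmt1 (u : X → ℝ) (un : ℕ → X → ℝ) (hu : FUSC u) (hun : ∀ n, FUSC (un n)) :
    Tendsto (fun n => Hsend (un n) u) atTop (𝓝 0) ↔
      Tendsto (fun n => Hend (un n) u) atTop (𝓝 0) ∧
        Tendsto (fun n => HXdist (acut (un n) 0) (acut u 0)) atTop (𝓝 0) := by
  have h0 : ∀ x, 0 ≤ u x := fun x => (hu.1 x).1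
  have hn0 : ∀ n x, 0 ≤ un n x := fun n x => ((hun n).1 x).1
  refine ⟨fun h => ⟨?_, ?_⟩, fun h => ?_⟩
  · exact tendsto_of_tendsto_of_tendsto_of_le_of_le tendsto_const_nhds h
      (fun _ => zero_le) fun n => Hend_le_Hsend (hn0 n) h0
  · exact tendsto_of_tendsto_of_tendsto_of_le_of_le tendsto_const_nhds h
      (fun _ => zero_le) fun n => HXdist_acut_zero_le_Hsend (hn0 n) h0
  · have hadd := h.1.add h.2
    rw [add_zero] at hadd
    exact tendsto_of_tendsto_of_tendsto_of_le_of_le tendsto_const_nhds hadd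
      (fun _ => zero_le) fun n => Hsend_le_Hend_add (hn0 n) h0

end
end

section
/- Let (X,d) be a metric space and let u, u_1, u_2, … be fuzzy sets in F¹_USC(X). Then: (i) if there is a dense subset P of (0,1) such that [u_n]_α Kuratowski converges to [u]_α for every α ∈ P, then u_n Γ-converges to u; (ii) if u_n Γ-converges to u, then [u_n]_α Kuratowski converges to [u]_α for every α ∈ (0,1) \ P(u). -/
open Set Filter Topology MeasureTheory
open scoped ENNReal NNReal

noncomputable section

variable {X : Type*} [MetricSpace X]

theorem kurLiminf_subset_kurLimsup {Y : Type*} [TopologicalSpace Y] (C : ℕ → Set Y) :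
    KurLiminf C ⊆ KurLimsup C := by
  rintro y ⟨f, hf, hy⟩
  exact ⟨id, strictMono_id, f, hf, hy⟩

theorem kurConv_of_subset {Y : Type*} [TopologicalSpace Y] {C : ℕ → Set Y} {L : Set Y}
    (hinf : L ⊆ KurLiminf C) (hsup : KurLimsup C ⊆ L) : KurConv C L :=
  ⟨((kurLiminf_subset_kurLimsup C).trans hsup).antisymm hinf,
    hsup.antisymm (hinf.trans (kurLiminf_subset_kurLimsup C))⟩

theorem mem_kurLiminf_of_eventually {Y : Type*} [PseudoMetricSpace Y] {C : ℕ → Set Y}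
    (hC : ∀ n, (C n).Nonempty) {y : Y}
    (h : ∀ ε > 0, ∀ᶠ n in atTop, ∃ z ∈ C n, dist y z < ε) : y ∈ KurLiminf C := by
  have hlt (n : ℕ) : Metric.infDist y (C n) < Metric.infDist y (C n) + 1 / ((n : ℝ) + 1) :=
    lt_add_of_pos_right _ Nat.one_div_pos_of_nat
  choose f hf hfy using fun n => (Metric.infDist_lt_iff (hC n)).1 (hlt n)
  have hinf : Tendsto (fun n => Metric.infDist y (C n)) atTop (𝓝 0) := by
    rw [Metric.tendsto_nhds]
    intro ε hε
    filter_upwards [h ε hε] with n hn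
    rw [Real.dist_0_eq_abs, abs_of_nonneg Metric.infDist_nonneg]
    exact (Metric.infDist_lt_iff (hC n)).2 hn
  have hsum := hinf.add (tendsto_one_div_add_atTop_nhds_zero_nat (𝕜 := ℝ))
  rw [add_zero] at hsum
  refine ⟨f, hf, tendsto_iff_dist_tendsto_zero.2 ?_⟩
  exact squeeze_zero (fun n => dist_nonneg) (fun n => (dist_comm _ _).trans_le (hfy n).le) hsum

theorem isClosed_kurLiminf {Y : Type*} [PseudoMetricSpace Y] {C : ℕ → Set Y}
    (hC : ∀ n, (C n).Nonempty) : IsClosed (KurLiminf C) := by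
  refine isClosed_of_closure_subset fun y hy => mem_kurLiminf_of_eventually hC fun ε hε => ?_
  obtain ⟨z, ⟨f, hf, hz⟩, hyz⟩ := Metric.mem_closure_iff.1 hy ε hε
  have := (tendsto_const_nhds (x := y)).dist hz
  filter_upwards [this.eventually_lt_const hyz] with n hn using ⟨f n, hf n, hn⟩

theorem mem_kurLimsup_of_eventually {Y : Type*} [TopologicalSpace Y] {C : ℕ → Set Y}
    {φ : ℕ → ℕ} (hφ : StrictMono φ) {f : ℕ → Y} {y : Y}
    (hf : ∀ᶠ k in atTop, f k ∈ C (φ k)) (hy : Tendsto f atTop (𝓝 y)) : y ∈ KurLimsup C := by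
  obtain ⟨N, hN⟩ := eventually_atTop.1 hf
  exact ⟨fun k => φ (k + N), fun a b hab => hφ (Nat.add_lt_add_right hab N),
    fun k => f (k + N), fun k => hN _ (Nat.le_add_left N k), hy.comp (tendsto_add_atTop_nat N)⟩

theorem DenseIn.exists_between {P : Set ℝ} (hP : DenseIn P (Ioo (0:ℝ) 1)) {a b : ℝ}
    (ha : 0 ≤ a) (hb : b ≤ 1) (hab : a < b) : ∃ c ∈ P, a < c ∧ c < b := by
  obtain ⟨m, ham, hmb⟩ := _root_.exists_between hab
  have hm : m ∈ closure P := hP.2 ⟨ha.trans_lt ham, hmb.trans_le hb⟩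
  obtain ⟨c, hc, hcP⟩ := mem_closure_iff.1 hm (Ioo a b) isOpen_Ioo ⟨ham, hmb⟩
  exact ⟨c, hcP, hc⟩

theorem mem_acut_of_pos {u : X → ℝ} {α : ℝ} (hα : 0 < α) {x : X} :
    x ∈ acut u α ↔ α ≤ u x := by
  rw [acut, if_neg hα.ne', mem_ofPred_eq]

theorem gammaConv_of_kurConv_acut {u : X → ℝ} {un : ℕ → X → ℝ} (hu : FUSC u)
    (hun : ∀ n, FUSC (un n)) {P : Set ℝ} (hP : DenseIn P (Ioo (0:ℝ) 1))
    (h : ∀ α ∈ P, KurConv (fun n => acut (un n) α) (acut u α)) : GammaConv un u := by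
  have hzero (n : ℕ) (x : X) : (x, (0:ℝ)) ∈ endograph (un n) :=
    ⟨left_mem_Icc.2 zero_le_one, ((hun n).1 x).1⟩
  refine kurConv_of_subset ?_ ?_
  · rintro ⟨x, t⟩ ⟨⟨ht0, ht1⟩, htu⟩
    dsimp only at ht0 ht1 htu
    refine mem_kurLiminf_of_eventually (fun n => ⟨_, hzero n x⟩) fun ε hε => ?_
    rcases ht0.eq_or_lt with rfl | ht0
    · exact Eventually.of_forall fun n => ⟨_, hzero n x, by simpa using hε⟩
    obtain ⟨α, hαP, hα, hαt⟩ := hP.exists_between (le_max_left 0 (t - ε)) ht1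
      (max_lt ht0 (sub_lt_self t hε))
    have hα0 : 0 < α := (hP.1 hαP).1
    have hx : x ∈ KurLiminf fun n => acut (un n) α := by
      rw [(h α hαP).1, mem_acut_of_pos hα0]
      exact hαt.le.trans htu
    obtain ⟨f, hf, hfx⟩ := hx
    filter_upwards [Metric.tendsto_nhds.1 hfx ε hε] with n hn
    refine ⟨(f n, α), ⟨⟨hα0.le, (hP.1 hαP).2.le⟩, (mem_acut_of_pos hα0).1 (hf n)⟩, ?_⟩
    rw [Prod.dist_eq, max_lt_iff]
    refine ⟨by rwa [dist_comm], ?_⟩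
    have := (le_max_right 0 (t - ε)).trans_lt hα
    rw [Real.dist_eq, abs_lt]
    constructor <;> dsimp only <;> linarith
  · rintro ⟨x, t⟩ ⟨φ, hφ, f, hf, hft⟩
    have ht : t ∈ Icc (0:ℝ) 1 :=
      isClosed_Icc.mem_of_tendsto hft.snd_nhds (Eventually.of_forall fun k => (hf k).1)
    refine ⟨ht, le_of_not_gt fun hlt => ?_⟩
    obtain ⟨α, hαP, hα, hαt⟩ := hP.exists_between (hu.1 x).1 ht.2 hlt
    have hα0 : 0 < α := (hP.1 hαP).1
    have hx : x ∈ KurLimsup fun n => acut (un n) α := by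
      refine mem_kurLimsup_of_eventually hφ ?_ hft.fst_nhds
      filter_upwards [hft.snd_nhds.eventually_const_lt hαt] with k hk
      exact (mem_acut_of_pos hα0).2 (hk.le.trans (hf k).2)
    rw [(h α hαP).2, mem_acut_of_pos hα0] at hx
    exact hα.not_ge hx

theorem GammaConv.kurConv_acut {u : X → ℝ} {un : ℕ → X → ℝ} (hu : FUSC u)
    (hun : ∀ n, FUSC (un n)) (h : GammaConv un u) {α : ℝ} (hα : α ∈ Ioo (0:ℝ) 1 \ Pset u) :
    KurConv (fun n => acut (un n) α) (acut u α) := by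
  obtain ⟨hα01, hαP⟩ := hα
  have hαI : α ∈ Icc (0:ℝ) 1 := Ioo_subset_Icc_self hα01
  have hcut {v : X → ℝ} {x : X} : x ∈ acut v α ↔ α ≤ v x := mem_acut_of_pos hα01.1
  have hclosure : closure {x | α < u x} ⊆ acut u α :=
    closure_minimal (fun x hx => hcut.2 (le_of_lt hx)) (hu.2 α hαI).2
  have hdense : acut u α ⊆ closure {x | α < u x} := by
    by_contra hne
    exact hαP ⟨hα01, hclosure, hne⟩
  have hne (n : ℕ) : (acut (un n) α).Nonempty := ((hun n).2 α hαI).1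
  refine kurConv_of_subset (hdense.trans (closure_minimal ?_ (isClosed_kurLiminf hne))) ?_
  · intro x hx
    have hxu : (x, u x) ∈ KurLiminf fun n => endograph (un n) := by
      rw [h.1]
      exact ⟨hu.1 x, le_rfl⟩
    obtain ⟨f, hf, hfx⟩ := hxu
    refine mem_kurLiminf_of_eventually hne fun ε hε => ?_
    filter_upwards [hfx.snd_nhds.eventually_const_lt hx,
      Metric.tendsto_nhds.1 hfx.fst_nhds ε hε] with n hn hdist
    exact ⟨(f n).1, hcut.2 (hn.le.trans (hf n).2), by rwa [dist_comm]⟩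
  · rintro x ⟨φ, hφ, f, hf, hfx⟩
    have hx : (x, α) ∈ KurLimsup fun n => endograph (un n) :=
      ⟨φ, hφ, fun k => (f k, α), fun k => ⟨hαI, hcut.1 (hf k)⟩,
        hfx.prodMk_nhds tendsto_const_nhds⟩
    rw [h.2] at hx
    exact hcut.2 hx.2

/-- (i) Kuratowski convergence of α-cuts on a dense set of levels implies
Γ-convergence; (ii) Γ-convergence implies Kuratowski convergence of α-cuts off `P(u)`. -/
theorem stmt5 (u : X → ℝ) (un : ℕ → X → ℝ) (hu : FUSC u) (hun : ∀ n, FUSC (un n)) :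
    ((∃ P : Set ℝ, DenseIn P (Ioo (0:ℝ) 1) ∧
        ∀ α ∈ P, KurConv (fun n => acut (un n) α) (acut u α)) →
      GammaConv un u) ∧
    (GammaConv un u →
      ∀ α ∈ Ioo (0:ℝ) 1 \ Pset u, KurConv (fun n => acut (un n) α) (acut u α)) := by
  exact ⟨fun ⟨_, hP, h⟩ => gammaConv_of_kurConv_acut hu hun hP h,
    fun h _ hα => h.kurConv_acut hu hun hα⟩

end
end

section
/- Let (X,d) be a metric space, let u ∈ F¹_USCG(X) and let u_1, u_2, … be fuzzy sets in F¹_USC(X). Then the following are equivalent: (i) H_end(u_n, u) → 0; (ii) H([u_n]_α, [u]_α) → 0 for Lebesgue-almost every α ∈ (0,1); (iii) H([u_n]_α, [u]_α) → 0 for all α ∈ (0,1) \ P_0(u); (iv) there is a dense subset P of (0,1) \ P_0(u) such that H([u_n]_α, [u]_α) → 0 for all α ∈ P; (v) there is a countable dense subset P of (0,1) \ P_0(u) such that H([u_n]_α, [u]_α) → 0 for all α ∈ P. -/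
open Set Filter Topology MeasureTheory
open scoped ENNReal NNReal

noncomputable section

variable {X : Type*} [MetricSpace X]

theorem hStar_le_of_forall_exists {Y : Type*} {ρ : Y → Y → ℝ≥0∞} {A B : Set Y} {ε : ℝ≥0∞}
    (h : ∀ a ∈ A, ∃ b ∈ B, ρ a b ≤ ε) : hStar ρ A B ≤ ε := by
  refine iSup₂_le fun a ha => ?_
  obtain ⟨b, hb, hab⟩ := h a ha
  exact (iInf₂_le b hb).trans hab

theorem exists_lt_of_hStar_lt {Y : Type*} {ρ : Y → Y → ℝ≥0∞} {A B : Set Y} {ε : ℝ≥0∞}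
    (h : hStar ρ A B < ε) {a : Y} (ha : a ∈ A) : ∃ b ∈ B, ρ a b < ε := by
  have h' : ⨅ b ∈ B, ρ a b < ε :=
    (le_iSup₂ (f := fun a (_ : a ∈ A) => ⨅ b ∈ B, ρ a b) a ha).trans_lt h
  simpa only [iInf_lt_iff, exists_prop] using h'

theorem acut_of_pos (u : X → ℝ) {α : ℝ} (hα : 0 < α) : acut u α = {x | α ≤ u x} :=
  if_neg hα.ne'

theorem isSeparable_support {u : X → ℝ} (hu : FUSCG u) :
    TopologicalSpace.IsSeparable {x | 0 < u x} := by
  have hsub : {x | 0 < u x} ⊆ ⋃ n : ℕ, acut u (1 / ((n : ℝ) + 1)) := by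
    intro x hx
    obtain ⟨n, hn⟩ := exists_nat_one_div_lt (mem_ofPred.1 hx)
    refine mem_iUnion.2 ⟨n, ?_⟩
    rw [acut_of_pos u Nat.one_div_pos_of_nat]
    exact hn.le
  refine TopologicalSpace.IsSeparable.mono (.iUnion fun n => (hu.2 _ ⟨?_, ?_⟩).isSeparable) hsub
  · exact Nat.one_div_pos_of_nat
  · rw [div_le_one (by positivity)]
    linarith [n.cast_nonneg (α := ℝ)]

/-- The values taken at points that are not limits of points with strictly larger values form
a countable set. -/
theorem countable_Dset {u : X → ℝ} (hu : FUSCG u) : (Dset u).Countable := by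
  obtain ⟨c, hc, hcl⟩ := isSeparable_support hu
  have key : ∀ α ∈ Dset u, ∃ p : X × ℚ, p ∈ c ×ˢ (univ : Set ℚ) ∧
      (∃ x, u x = α ∧ dist x p.1 < p.2) ∧ ∀ y, dist y p.1 < p.2 → u y ≤ α := by
    rintro α ⟨hα, hD⟩
    obtain ⟨x, hx, hxn⟩ := not_subset.1 hD
    rw [acut_of_pos u hα.1] at hx
    rw [Metric.mem_closure_iff] at hxn
    push Not at hxn
    obtain ⟨r, hr, hball⟩ := hxn
    have hxe : u x = α := by
      refine le_antisymm (not_lt.1 fun h => ?_) hx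
      have := hball x h
      rw [dist_self] at this
      linarith
    obtain ⟨y, hy, hxy⟩ := Metric.mem_closure_iff.1 (hcl (show 0 < u x from hxe ▸ hα.1)) (r / 3)
      (by positivity)
    obtain ⟨q, hq1, hq2⟩ := exists_rat_btwn (show r / 3 < r / 2 by linarith)
    refine ⟨(y, q), ⟨hy, mem_univ _⟩, ⟨x, hxe, hxy.trans hq1⟩, fun z hz => ?_⟩
    by_contra h
    have h1 := hball z (not_le.1 h)
    have h2 := dist_triangle_right x z y
    simp only at hz
    linarith
  rcases (Dset u).eq_empty_or_nonempty with hD | ⟨α₀, hα₀⟩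
  · simp [hD]
  have : Nonempty (X × ℚ) := ⟨(key α₀ hα₀).choose⟩
  choose! f hf using key
  refine MapsTo.countable_of_injOn (f := f) (fun α hα => (hf α hα).1) ?_
    (hc.prod countable_univ)
  intro α hα β hβ hab
  obtain ⟨-, ⟨x, rfl, hx⟩, hx'⟩ := hf α hα
  obtain ⟨-, ⟨y, rfl, hy⟩, hy'⟩ := hf β hβ
  exact le_antisymm (hy' x (hab ▸ hx)) (hx' y (hab ▸ hy))

theorem exists_acut_subset_thickening_of_lt {u : X → ℝ} (hu : FUSCG u) {α ε : ℝ}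
    (hα : α ∈ Ioo (0 : ℝ) 1) (hε : 0 < ε) :
    ∃ β ∈ Ioo 0 α, acut u β ⊆ Metric.thickening ε (acut u α) := by
  have hne : Nonempty (Ico (α / 2) α) := ⟨⟨α / 2, le_rfl, by linarith [hα.1]⟩⟩
  have hK : IsCompact (acut u (α / 2) \ Metric.thickening ε (acut u α)) :=
    (hu.2 (α / 2) ⟨by linarith [hα.1], by linarith [hα.1, hα.2]⟩).diff Metric.isOpen_thickening
  obtain ⟨β, hβ⟩ := hK.elim_directed_cover (fun β : Ico (α / 2) α => (acut u β)ᶜ)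
    (fun β => (hu.1.2 _ ⟨by linarith [hα.1, β.2.1], by linarith [hα.2, β.2.2]⟩).2.isOpen_compl)
    (fun x hx => by
      have hxα : u x < α := by
        by_contra h
        refine hx.2 (Metric.self_subset_thickening hε _ ?_)
        rw [acut_of_pos u hα.1]
        exact not_lt.1 h
      obtain ⟨β, h1, h2⟩ := exists_between hxα
      have hx2 := hx.1
      rw [acut_of_pos u (half_pos hα.1), mem_ofPred] at hx2
      refine mem_iUnion.2 ⟨⟨β, by linarith, h2⟩, ?_⟩
      rw [acut_of_pos u (show 0 < β by linarith [hα.1])]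
      exact not_le.2 h1)
    (directed_of_isDirected_le fun β γ hβγ => by
      have hβ0 : (0 : ℝ) < β := by linarith [hα.1, β.2.1]
      have hγ0 : (0 : ℝ) < γ := by linarith [hα.1, γ.2.1]
      refine compl_subset_compl.2 ?_
      rw [acut_of_pos u hβ0, acut_of_pos u hγ0]
      exact fun x hx => le_trans (show (β : ℝ) ≤ γ from hβγ) hx)
  refine ⟨β, ⟨by linarith [hα.1, β.2.1], β.2.2⟩, fun x hx => ?_⟩
  by_contra h
  refine hβ ⟨?_, h⟩ hx
  rw [acut_of_pos u (by linarith [hα.1, β.2.1] : (0 : ℝ) < β)] at hx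
  rw [acut_of_pos u (half_pos hα.1)]
  exact β.2.1.trans hx

theorem exists_acut_subset_thickening_of_gt {u : X → ℝ} (hu : FUSCG u) {α ε : ℝ}
    (hα : α ∈ Ioo (0 : ℝ) 1) (hD : α ∉ Dset u) (hε : 0 < ε) :
    ∃ β > α, acut u α ⊆ Metric.thickening ε (acut u β) := by
  have hne : Nonempty (Ioi α) := ⟨⟨α + 1, by simp⟩⟩
  have hcl : acut u α ⊆ closure {x | α < u x} := by
    by_contra h
    exact hD ⟨hα, h⟩
  obtain ⟨β, hβ⟩ := (hu.2 _ ⟨hα.1, hα.2.le⟩).elim_directed_cover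
    (fun β : (Ioi α)ᵒᵈ => Metric.thickening ε (acut u (OrderDual.ofDual β : Ioi α)))
    (fun β => Metric.isOpen_thickening)
    (fun x hx => by
      obtain ⟨y, hy, hxy⟩ := Metric.mem_closure_iff.1 (hcl hx) ε hε
      refine mem_iUnion.2 ⟨OrderDual.toDual ⟨u y, hy⟩, Metric.mem_thickening_iff.2 ⟨y, ?_, hxy⟩⟩
      rw [OrderDual.ofDual_toDual, acut_of_pos u (hα.1.trans hy)]
      exact le_refl (u y))
    (directed_of_isDirected_le fun β γ hβγ => by
      refine Metric.thickening_subset_of_subset _ ?_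
      rw [acut_of_pos u (hα.1.trans (OrderDual.ofDual β).2),
        acut_of_pos u (hα.1.trans (OrderDual.ofDual γ).2)]
      exact fun x hx => le_trans (show ((OrderDual.ofDual γ : Ioi α) : ℝ) ≤
        (OrderDual.ofDual β : Ioi α) from hβγ) hx)
  exact ⟨_, (OrderDual.ofDual β).2, hβ⟩

theorem P0set_subset_Dset {u : X → ℝ} (hu : FUSCG u) : P0set u ⊆ Dset u := by
  rintro α ⟨hα, hP⟩
  by_contra hD
  refine hP (tendsto_nhdsWithin_of_tendsto_nhds ?_)
  refine ENNReal.tendsto_nhds_zero.2 fun ε hε => ?_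
  obtain ⟨r, -, hr⟩ := ENNReal.lt_iff_exists_real_btwn.1 hε
  have hr0 : 0 < r := ENNReal.ofReal_pos.1 hr.1
  obtain ⟨β, hβ, hβs⟩ := exists_acut_subset_thickening_of_lt hu hα hr0
  obtain ⟨γ, hγ, hγs⟩ := exists_acut_subset_thickening_of_gt hu hα hD hr0
  filter_upwards [Ioo_mem_nhds hβ.2 hγ, Ioi_mem_nhds hα.1] with t ht ht0
  refine max_le (hStar_le_of_forall_exists fun x hx => ?_)
    (hStar_le_of_forall_exists fun x hx => ?_)
  · rw [acut_of_pos u ht0] at hx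
    obtain ⟨y, hy, hxy⟩ := (Metric.mem_thickening_iff_exists_edist_lt _ _).1
      (hβs (show x ∈ acut u β by rw [acut_of_pos u hβ.1]; exact ht.1.le.trans hx))
    exact ⟨y, hy, (hxy.trans hr.2).le⟩
  · obtain ⟨y, hy, hxy⟩ := (Metric.mem_thickening_iff_exists_edist_lt _ _).1 (hγs hx)
    refine ⟨y, ?_, (hxy.trans hr.2).le⟩
    rw [acut_of_pos u (hα.1.trans hγ)] at hy
    rw [acut_of_pos u ht0]
    exact ht.2.le.trans hy

theorem countable_P0set {u : X → ℝ} (hu : FUSCG u) : (P0set u).Countable :=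
  (countable_Dset hu).mono (P0set_subset_Dset hu)

theorem Ioo_subset_closure_diff_P0set {u : X → ℝ} (hu : FUSCG u) :
    Ioo (0 : ℝ) 1 ⊆ closure (Ioo (0 : ℝ) 1 \ P0set u) :=
  ((countable_P0set hu).dense_compl ℝ).open_subset_closure_inter isOpen_Ioo

theorem exists_near_of_dbar_lt {v w : X → ℝ} {δ : ℝ} {ε : ℝ≥0∞} {α : ℝ} (hα : α ∈ Icc (0 : ℝ) 1)
    (h : HPstar (endograph v) (endograph w) < min ε (ENNReal.ofReal δ)) {x : X} (hx : α ≤ v x) :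
    ∃ y, α - δ ≤ w y ∧ edist x y < ε := by
  obtain ⟨⟨y, t⟩, hy, hd⟩ := exists_lt_of_hStar_lt h (show (x, α) ∈ endograph v from ⟨hα, hx⟩)
  obtain ⟨hd1, hd2⟩ := lt_min_iff.1 hd
  refine ⟨y, ?_, le_self_add.trans_lt hd1⟩
  have h1 : edist α t < ENNReal.ofReal δ := le_add_self.trans_lt hd2
  rw [edist_dist, ENNReal.ofReal_lt_ofReal_iff_of_nonneg dist_nonneg, Real.dist_eq] at h1
  have h2 : t ≤ w y := hy.2
  linarith [(abs_lt.1 h1).2]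

theorem tendsto_acut_of_tendsto_Hend {u : X → ℝ} {un : ℕ → X → ℝ}
    (h : Tendsto (fun n => Hend (un n) u) atTop (𝓝 0)) {α : ℝ}
    (hα : α ∈ Ioo (0 : ℝ) 1 \ P0set u) :
    Tendsto (fun n => HXdist (acut (un n) α) (acut u α)) atTop (𝓝 0) := by
  have hcont : Tendsto (fun β => HXdist (acut u β) (acut u α)) (𝓝 α) (𝓝 0) := by
    have hc : α ∈ {α | Tendsto (fun β => HXdist (acut u β) (acut u α)) (𝓝[Icc (0:ℝ) 1] α) (𝓝 0)} :=
      by_contra fun hc => hα.2 ⟨hα.1, hc⟩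
    rwa [mem_ofPred, nhdsWithin_eq_nhds.2 (Icc_mem_nhds hα.1.1 hα.1.2)] at hc
  refine ENNReal.tendsto_nhds_zero.2 fun ε hε => ?_
  have hε2 : 0 < ε / 2 := ENNReal.half_pos hε.ne'
  obtain ⟨ρ, hρ, hρs⟩ := Metric.eventually_nhds_iff.1
    ((hcont.eventually_lt_const hε2).and (Ioo_mem_nhds hα.1.1 hα.1.2))
  set δ := ρ / 2 with hδ
  have hδ0 : 0 < δ := half_pos hρ
  obtain ⟨hl, hl1⟩ := hρs (y := α - δ) (by
    rw [Real.dist_eq, abs_lt]; constructor <;> linarith)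
  obtain ⟨hr, hr1⟩ := hρs (y := α + δ) (by
    rw [Real.dist_eq, abs_lt]; constructor <;> linarith)
  filter_upwards [h.eventually_lt_const (lt_min hε2 (ENNReal.ofReal_pos.2 hδ0))] with n hn
  obtain ⟨hn1, hn2⟩ := max_lt_iff.1 hn
  refine max_le (hStar_le_of_forall_exists fun x hx => ?_)
    (hStar_le_of_forall_exists fun x hx => ?_)
  · rw [acut_of_pos _ hα.1.1] at hx
    obtain ⟨y, hy, hxy⟩ := exists_near_of_dbar_lt (Ioo_subset_Icc_self hα.1) hn1 hx
    obtain ⟨z, hz, hyz⟩ := exists_lt_of_hStar_lt (max_lt_iff.1 hl).1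
      (show y ∈ acut u (α - δ) by rwa [acut_of_pos _ hl1.1])
    refine ⟨z, hz, (edist_triangle x y z).trans ?_⟩
    exact (add_le_add hxy.le hyz.le).trans_eq (ENNReal.add_halves ε)
  · obtain ⟨y, hy, hxy⟩ := exists_lt_of_hStar_lt (max_lt_iff.1 hr).2 hx
    rw [acut_of_pos _ hr1.1] at hy
    obtain ⟨z, hz, hyz⟩ := exists_near_of_dbar_lt (Ioo_subset_Icc_self hr1) hn2 hy
    refine ⟨z, ?_, (edist_triangle x y z).trans ?_⟩
    · rw [acut_of_pos _ hα.1.1]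
      simpa using hz
    · exact (add_le_add hxy.le hyz.le).trans_eq (ENNReal.add_halves ε)

/-- Closeness of the cuts at finitely many well-spread levels controls the endographs. -/
theorem HPstar_endograph_le {v w : X → ℝ} (hw : ∀ x, 0 ≤ w x) {N : ℕ} (hN : 0 < N) {a : ℕ → ℝ}
    (ha : ∀ i < N, a i ∈ Ioo ((i : ℝ) / N) ((i + 1) / N))
    (h : ∀ i < N, HXstar (acut v (a i)) (acut w (a i)) < ENNReal.ofReal (1 / N)) :
    HPstar (endograph v) (endograph w) ≤ ENNReal.ofReal (3 / N) := by
  have hN' : (0 : ℝ) < N := Nat.cast_pos.2 hN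
  refine hStar_le_of_forall_exists ?_
  rintro ⟨x, t⟩ ⟨⟨ht0, ht1⟩, htx⟩
  dsimp only at ht0 ht1 htx
  have hfl := Nat.floor_le (mul_nonneg ht0 hN'.le)
  have hlt := Nat.lt_floor_add_one (t * N)
  rcases hk : ⌊t * N⌋₊ with _ | i
  · refine ⟨(x, 0), ⟨⟨le_rfl, zero_le_one⟩, hw x⟩, ?_⟩
    rw [hk] at hlt
    have h1 : t ≤ 3 / N := by
      rw [le_div_iff₀ hN']
      norm_num at hlt
      linarith
    simpa [dbar, edist_dist, abs_of_nonneg ht0] using ENNReal.ofReal_le_ofReal h1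
  · rw [hk] at hlt hfl
    push_cast at hlt hfl
    have hi : i < N := by
      have : (i : ℝ) < N := by nlinarith
      exact_mod_cast this
    obtain ⟨h1, h2⟩ := ha i hi
    have hpos : 0 < a i := lt_of_le_of_lt (by positivity) h1
    rw [div_lt_iff₀ hN'] at h1
    have h2' := (lt_div_iff₀ hN').1 h2
    have hle : a i ≤ t := by
      by_contra hc
      nlinarith
    obtain ⟨y, hy, hxy⟩ := exists_lt_of_hStar_lt (h i hi)
      (show x ∈ acut v (a i) by rw [acut_of_pos _ hpos]; exact hle.trans htx)
    rw [acut_of_pos _ hpos] at hy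
    refine ⟨(y, a i), ⟨⟨hpos.le, hle.trans ht1⟩, hy⟩, ?_⟩
    have h3 : edist t (a i) ≤ ENNReal.ofReal (2 / N) := by
      rw [edist_dist, Real.dist_eq, abs_of_nonneg (by linarith)]
      refine ENNReal.ofReal_le_ofReal ?_
      rw [le_div_iff₀ hN']
      nlinarith
    refine (add_le_add hxy.le h3).trans_eq ?_
    rw [← ENNReal.ofReal_add (by positivity) (by positivity)]
    congr 1
    ring

theorem tendsto_Hend_of_tendsto_acut {u : X → ℝ} {un : ℕ → X → ℝ} (hu : ∀ x, 0 ≤ u x)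
    (hun : ∀ n x, 0 ≤ un n x) {P : Set ℝ} (hP : Ioo (0 : ℝ) 1 ⊆ closure P)
    (h : ∀ α ∈ P, Tendsto (fun n => HXdist (acut (un n) α) (acut u α)) atTop (𝓝 0)) :
    Tendsto (fun n => Hend (un n) u) atTop (𝓝 0) := by
  refine ENNReal.tendsto_nhds_zero.2 fun ε hε => ?_
  obtain ⟨r, -, hr⟩ := ENNReal.lt_iff_exists_real_btwn.1 hε
  have hr0 : 0 < r := ENNReal.ofReal_pos.1 hr.1
  obtain ⟨m, hm⟩ := exists_nat_one_div_lt (show 0 < r / 3 by positivity)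
  obtain ⟨N, hN, hNr⟩ : ∃ N : ℕ, 0 < N ∧ 3 / (N : ℝ) ≤ r := by
    refine ⟨m + 1, m.succ_pos, ?_⟩
    rw [div_lt_iff₀ (by positivity)] at hm
    rw [div_le_iff₀ (by positivity)]
    push_cast
    linarith
  have hN' : (0 : ℝ) < N := Nat.cast_pos.2 hN
  have hex : ∀ i < N, ∃ α ∈ P, α ∈ Ioo ((i : ℝ) / N) ((i + 1) / N) := by
    intro i hi
    have hi' : (i : ℝ) + 1 ≤ N := by exact_mod_cast hi
    obtain ⟨c, hc⟩ := exists_between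
      (show (i : ℝ) / N < (i + 1) / N by gcongr; linarith)
    have hc01 : c ∈ Ioo (0 : ℝ) 1 :=
      ⟨lt_of_le_of_lt (by positivity) hc.1, hc.2.trans_le ((div_le_one hN').2 hi')⟩
    obtain ⟨α, h1, h2⟩ := mem_closure_iff.1 (hP hc01) _ isOpen_Ioo hc
    exact ⟨α, h2, h1⟩
  choose! a haP ha using hex
  have hev : ∀ᶠ n in atTop, ∀ i ∈ Finset.range N,
      HXdist (acut (un n) (a i)) (acut u (a i)) < ENNReal.ofReal (1 / N) :=
    (Finset.range N).eventually_all.2 fun i hi =>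
      (h _ (haP i (Finset.mem_range.1 hi))).eventually_lt_const
        (ENNReal.ofReal_pos.2 (by positivity))
  filter_upwards [hev] with n hn
  refine le_trans ?_ ((ENNReal.ofReal_le_ofReal hNr).trans hr.2.le)
  exact max_le
    (HPstar_endograph_le hu hN ha fun i hi => (max_lt_iff.1 (hn i (Finset.mem_range.2 hi))).1)
    (HPstar_endograph_le (hun n) hN ha
      fun i hi => (max_lt_iff.1 (hn i (Finset.mem_range.2 hi))).2)

/-- level decomposition of `H_end` convergence for `u ∈ F¹_USCG(X)`. -/
theorem stmt11 (u : X → ℝ) (un : ℕ → X → ℝ) (hu : FUSCG u) (hun : ∀ n, FUSC (un n)) :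
    List.TFAE
      [ Tendsto (fun n => Hend (un n) u) atTop (𝓝 0),
        ∀ᵐ α ∂(volume.restrict (Ioo (0:ℝ) 1)),
          Tendsto (fun n => HXdist (acut (un n) α) (acut u α)) atTop (𝓝 0),
        ∀ α ∈ Ioo (0:ℝ) 1 \ P0set u,
          Tendsto (fun n => HXdist (acut (un n) α) (acut u α)) atTop (𝓝 0),
        ∃ P : Set ℝ, DenseIn P (Ioo (0:ℝ) 1 \ P0set u) ∧
          ∀ α ∈ P, Tendsto (fun n => HXdist (acut (un n) α) (acut u α)) atTop (𝓝 0),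
        ∃ P : Set ℝ, P.Countable ∧ DenseIn P (Ioo (0:ℝ) 1 \ P0set u) ∧
          ∀ α ∈ P, Tendsto (fun n => HXdist (acut (un n) α) (acut u α)) atTop (𝓝 0) ] := by
  tfae_have 1 → 3 := fun h α hα => tendsto_acut_of_tendsto_Hend h hα
  tfae_have 3 → 2 := fun h => by
    rw [ae_restrict_iff' measurableSet_Ioo]
    filter_upwards [(countable_P0set hu).ae_notMem volume] with α hα hα'
    exact h α ⟨hα', hα⟩
  tfae_have 2 → 4 := fun h => by
    rw [ae_restrict_iff' measurableSet_Ioo] at h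
    have hd := Measure.dense_of_ae (h.and ((countable_P0set hu).ae_notMem volume))
    exact ⟨_, ⟨fun α hα => ⟨hα.1, hα.2.2⟩,
      sdiff_subset.trans (hd.open_subset_closure_inter isOpen_Ioo)⟩, fun α hα => hα.2.1 hα.1⟩
  tfae_have 4 → 5 := by
    rintro ⟨P, ⟨hPs, hPd⟩, hP⟩
    obtain ⟨Q, hQP, hQc, hQd⟩ :=
      (TopologicalSpace.IsSeparable.of_separableSpace P).exists_countable_dense_subset
    exact ⟨Q, hQc, ⟨hQP.trans hPs, hPd.trans (closure_minimal hQd isClosed_closure)⟩,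
      fun α hα => hP α (hQP hα)⟩
  tfae_have 5 → 1 := by
    rintro ⟨P, -, ⟨-, hPd⟩, hP⟩
    exact tendsto_Hend_of_tendsto_acut (fun x => (hu.1.1 x).1) (fun n x => ((hun n).1 x).1)
      ((Ioo_subset_closure_diff_P0set hu).trans (closure_minimal hPd isClosed_closure)) hP
  tfae_finish

end
end
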